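/- Let |ψ⟩ be a fully entangled stabilizer state on n ≥ 3 qubits such that 𝒮(ψ) = ℳ(ψ), i.e., 𝒮(ψ) is generated by its minimal elements. Then LU(ψ) = LC(ψ). -/

import Mathlib

open Matrix

noncomputable section

/-- Pauli matrices: `0 ↦ σ₀` (identity), `1 ↦ σₓ`, `2 ↦ σ_y`, `3 ↦ σ_z`. -/
def pauliMat : Fin 4 → Matrix (Fin 2) (Fin 2) ℂ :=
  ![1, !![0, 1; 1, 0], !![0, -Complex.I; Complex.I, 0], !![1, 0; 0, -1]]

/-- Tensor (Kronecker) product of a family of one-qubit operators, as an operator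
on qubits indexed by `ι`. -/
def kron {ι : Type} [Fintype ι] (U : ι → Matrix (Fin 2) (Fin 2) ℂ) :
    Matrix (ι → Fin 2) (ι → Fin 2) ℂ :=
  Matrix.of fun x y => ∏ i, U i (x i) (y i)

/-- An element of the Pauli group: a phase in `{1, -1, i, -i}` together with a
Pauli label (`σ₀, σₓ, σ_y, σ_z`) on every qubit. -/
structure PauliOp (ι : Type) where
  phase : ℂ
  label : ι → Fin 4
  phase_ok : phase = 1 ∨ phase = -1 ∨ phase = Complex.I ∨ phase = -Complex.I

noncomputable instance {ι : Type} : DecidableEq (PauliOp ι) := Classical.decEq _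

/-- The matrix of a Pauli group element. -/
def PauliOp.toMatrix {ι : Type} [Fintype ι] (M : PauliOp ι) :
    Matrix (ι → Fin 2) (ι → Fin 2) ℂ :=
  M.phase • kron fun i => pauliMat (M.label i)

/-- The support of a Pauli operator: the set of qubits on which it acts nontrivially. -/
def PauliOp.support {ι : Type} [Fintype ι] [DecidableEq ι] (M : PauliOp ι) : Finset ι :=
  Finset.univ.filter fun i => M.label i ≠ 0

/-- A (maximal) stabilizer on the qubits indexed by `ι`: an abelian subgroup of the
Pauli group of cardinality `2^|ι|` which does not contain `-I`. -/
structure Stabilizer (ι : Type) [Fintype ι] [DecidableEq ι] where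
  elems : Finset (PauliOp ι)
  one_mem : ∃ M ∈ elems, PauliOp.toMatrix M = 1
  mul_mem : ∀ M ∈ elems, ∀ N ∈ elems, ∃ K ∈ elems,
    PauliOp.toMatrix K = PauliOp.toMatrix M * PauliOp.toMatrix N
  comm : ∀ M ∈ elems, ∀ N ∈ elems,
    PauliOp.toMatrix M * PauliOp.toMatrix N = PauliOp.toMatrix N * PauliOp.toMatrix M
  neg_one_not_mem : ∀ M ∈ elems, PauliOp.toMatrix M ≠ -1
  card_elems : elems.card = 2 ^ Fintype.card ι

variable {ι : Type} [Fintype ι] [DecidableEq ι]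

/-- `ψ` is the stabilizer state of the stabilizer `S`: it is a unit vector fixed by
every element of `S`. -/
def stabilizesState (S : Stabilizer ι) (ψ : (ι → Fin 2) → ℂ) : Prop :=
  (∑ x, Complex.normSq (ψ x)) = 1 ∧ ∀ M ∈ S.elems, (PauliOp.toMatrix M).mulVec ψ = ψ

/-- `ψ` is a stabilizer state. -/
def IsStabilizerState (ψ : (ι → Fin 2) → ℂ) : Prop :=
  ∃ S : Stabilizer ι, stabilizesState S ψ

/-- `A_ω(ψ)`: the number of stabilizer elements with support exactly `ω`. -/
def Aomega (S : Stabilizer ι) (ω : Finset ι) : ℕ :=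
  (S.elems.filter fun M => PauliOp.support M = ω).card

/-- `ω` is a minimal support of `S`: it is the support of some element of `S`, and no
element of `S` has nonempty support strictly contained in `ω`. -/
def IsMinimalSupport (S : Stabilizer ι) (ω : Finset ι) : Prop :=
  (∃ M ∈ S.elems, PauliOp.support M = ω) ∧
    ∀ M ∈ S.elems, PauliOp.support M ⊂ ω → PauliOp.support M = ∅

/-- The matrices of the minimal elements of `S` (the elements whose support is a
minimal support). -/
def minimalMatrices (S : Stabilizer ι) : Set (Matrix (ι → Fin 2) (ι → Fin 2) ℂ) :=
  {A | ∃ M ∈ S.elems, IsMinimalSupport S (PauliOp.support M) ∧ PauliOp.toMatrix M = A}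

/-- `M` belongs to the subgroup `ℳ(ψ)` of `S` generated by the minimal elements.
(Every stabilizer element is an involution, so the generated submonoid coincides with
the generated subgroup.) -/
def inMinimalSubgroup (S : Stabilizer ι) (M : PauliOp ι) : Prop :=
  M ∈ S.elems ∧ PauliOp.toMatrix M ∈ Submonoid.closure (minimalMatrices S)

/-- A one-qubit Clifford operation: a unitary mapping each of the three Pauli matrices
to a Pauli matrix, up to sign, under conjugation. -/
def IsClifford (U : Matrix (Fin 2) (Fin 2) ℂ) : Prop :=
  U ∈ Matrix.unitaryGroup (Fin 2) ℂ ∧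
    ∃ π : Equiv.Perm (Fin 3), ∀ u : Fin 3, ∃ s : ℂ, (s = 1 ∨ s = -1) ∧
      U * pauliMat u.succ * Uᴴ = s • pauliMat (π u).succ

/-- Local unitary equivalence of pure states. -/
def LUequiv (ψ φ : (ι → Fin 2) → ℂ) : Prop :=
  ∃ U : ι → Matrix (Fin 2) (Fin 2) ℂ,
    (∀ i, U i ∈ Matrix.unitaryGroup (Fin 2) ℂ) ∧ (kron U).mulVec ψ = φ

/-- Local Clifford equivalence of pure states. -/
def LCequiv (ψ φ : (ι → Fin 2) → ℂ) : Prop :=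
  ∃ U : ι → Matrix (Fin 2) (Fin 2) ℂ,
    (∀ i, IsClifford (U i)) ∧ (kron U).mulVec ψ = φ

/-- Local Clifford equivalence of (possibly mixed) states. -/
def LCequivMixed (ρ ρ' : Matrix (ι → Fin 2) (ι → Fin 2) ℂ) : Prop :=
  ∃ U : ι → Matrix (Fin 2) (Fin 2) ℂ,
    (∀ i, IsClifford (U i)) ∧ kron U * ρ * (kron U)ᴴ = ρ'

/-- A pure state is fully entangled if it is not a tensor product of states on two
complementary nonempty subsets of the qubits. -/
def FullyEntangled (ψ : (ι → Fin 2) → ℂ) : Prop :=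
  ¬ ∃ (ω : Finset ι) (φ : ({i // i ∈ ω} → Fin 2) → ℂ) (χ : ({i // i ∉ ω} → Fin 2) → ℂ),
      ω ≠ ∅ ∧ ω ≠ Finset.univ ∧
        ∀ x : ι → Fin 2, ψ x = φ (fun i => x i.1) * χ (fun i => x i.1)

/-- Recombine an assignment on `ω` and one on its complement into a global assignment. -/
def mergeAssign (ω : Finset ι) (x : {i // i ∈ ω} → Fin 2) (z : {i // i ∉ ω} → Fin 2) :
    ι → Fin 2 :=
  fun i => if h : i ∈ ω then x ⟨i, h⟩ else z ⟨i, h⟩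

/-- The reduced density matrix `ρ_ω(ψ)` of the pure state `ψ` on the qubits in `ω`
(partial trace of `|ψ⟩⟨ψ|` over the qubits outside `ω`). -/
def reducedState (ψ : (ι → Fin 2) → ℂ) (ω : Finset ι) :
    Matrix ({i // i ∈ ω} → Fin 2) ({i // i ∈ ω} → Fin 2) ℂ :=
  Matrix.of fun x y =>
    ∑ z : {i // i ∉ ω} → Fin 2, ψ (mergeAssign ω x z) * (starRingEnd ℂ) (ψ (mergeAssign ω y z))

/-- The restriction `α_M M_{i₁} ⊗ ⋯ ⊗ M_{i_k}` of a Pauli operator to the qubits in `ω`. -/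
def PauliOp.restrict (M : PauliOp ι) (ω : Finset ι) :
    Matrix ({i // i ∈ ω} → Fin 2) ({i // i ∈ ω} → Fin 2) ℂ :=
  M.phase • kron fun i : {i // i ∈ ω} => pauliMat (M.label i.1)

/-- The `n`-qubit GHZ state `(|0…0⟩ + |1…1⟩)/√2`. -/
def ghz (n : ℕ) : (Fin n → Fin 2) → ℂ :=
  fun x => if x = (fun _ => 0) ∨ x = (fun _ => 1) then ((Real.sqrt 2 : ℝ)⁻¹ : ℂ) else 0

/-- The `2n × 2n` binary symplectic form `P = [[0, I], [I, 0]]`. -/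
def Pmat (n : ℕ) : Matrix (Fin n ⊕ Fin n) (Fin n ⊕ Fin n) (ZMod 2) :=
  Matrix.fromBlocks 0 1 1 0

end

section SingleQubit

lemma pauliMat_mul (p q : Fin 4) :
    ∃ z : ℂ, z ≠ 0 ∧ pauliMat p * pauliMat q = z • pauliMat (p ^^^ q) := by
  have hI := Complex.I_ne_zero
  have hI' : -Complex.I ≠ 0 := neg_ne_zero.mpr hI
  have key : pauliMat p * pauliMat q = (1 : ℂ) • pauliMat (p ^^^ q) ∨
      pauliMat p * pauliMat q = Complex.I • pauliMat (p ^^^ q) ∨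
      pauliMat p * pauliMat q = (-Complex.I) • pauliMat (p ^^^ q) := by
    fin_cases p <;> fin_cases q <;>
      first
        | (left; ext i j; fin_cases i <;> fin_cases j <;>
            simp [pauliMat, Matrix.mul_apply, Fin.sum_univ_two]; done)
        | (right; left; ext i j; fin_cases i <;> fin_cases j <;>
            simp [pauliMat, Matrix.mul_apply, Fin.sum_univ_two]; done)
        | (right; right; ext i j; fin_cases i <;> fin_cases j <;>
            simp [pauliMat, Matrix.mul_apply, Fin.sum_univ_two]; done)
  rcases key with h | h | h
  exacts [⟨_, one_ne_zero, h⟩, ⟨_, hI, h⟩, ⟨_, hI', h⟩]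

lemma pauliMat_zero : pauliMat 0 = 1 := rfl

lemma pauliMat_sq (p : Fin 4) : pauliMat p * pauliMat p = 1 := by
  fin_cases p <;> ext i j <;> fin_cases i <;> fin_cases j <;>
    simp [pauliMat, Matrix.mul_apply, Fin.sum_univ_two]

lemma pauliMat_conjTranspose (p : Fin 4) : (pauliMat p)ᴴ = pauliMat p := by
  fin_cases p <;> ext i j <;> fin_cases i <;> fin_cases j <;>
    simp [pauliMat, Matrix.conjTranspose_apply]

lemma pauliMat_anticomm (p q : Fin 4) (hp : p ≠ 0) (hq : q ≠ 0) (hpq : p ≠ q) :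
    pauliMat p * pauliMat q = (-1 : ℂ) • (pauliMat q * pauliMat p) := by
  fin_cases p <;> fin_cases q <;> simp at hp hq hpq <;>
    (ext i j; fin_cases i <;> fin_cases j <;>
      simp [pauliMat, Matrix.mul_apply, Fin.sum_univ_two])

lemma eq_zero_of_pauliMat_eq_smul_one (p : Fin 4) (r : ℂ) (h : pauliMat p = r • 1) : p = 0 := by
  have h00 := congrFun (congrFun h 0) 0
  have h01 := congrFun (congrFun h 0) 1
  have h11 := congrFun (congrFun h 1) 1
  fin_cases p <;> simp [pauliMat] at h00 h01 h11 ⊢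
  rw [← h00] at h11
  norm_num [Complex.ext_iff] at h11

lemma pauliMat_expansion (A : Matrix (Fin 2) (Fin 2) ℂ) :
    A = ∑ p, ((1 / 2 : ℂ) * (pauliMat p * A).trace) • pauliMat p := by
  ext i j
  fin_cases i <;> fin_cases j <;>
    simp [pauliMat, Fin.sum_univ_four, Matrix.trace, Matrix.mul_apply, Fin.sum_univ_two,
      Matrix.sum_apply] <;> ring_nf <;> simp <;> ring

lemma half_trace_pauliMat_mul (p q : Fin 4) :
    (1 / 2 : ℂ) * (pauliMat p * pauliMat q).trace = if p = q then 1 else 0 := by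
  fin_cases p <;> fin_cases q <;>
    simp [pauliMat, Matrix.trace, Fin.sum_univ_two] <;> norm_num

lemma sum_pauliMat_mul_pauliMat (x u y v : Fin 2) :
    ∑ p, pauliMat p x u * pauliMat p y v = if u = y ∧ v = x then 2 else 0 := by
  fin_cases x <;> fin_cases u <;> fin_cases y <;> fin_cases v <;>
    simp [pauliMat, Fin.sum_univ_four] <;> norm_num

/-- The matrix of conjugation by `U` in the Pauli basis. -/
noncomputable def pauliTransfer (U : Matrix (Fin 2) (Fin 2) ℂ) (b a : Fin 4) : ℂ :=
  (1 / 2 : ℂ) * (pauliMat b * (U * pauliMat a * Uᴴ)).trace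

lemma conj_pauliMat (U : Matrix (Fin 2) (Fin 2) ℂ) (a : Fin 4) :
    U * pauliMat a * Uᴴ = ∑ b, pauliTransfer U b a • pauliMat b :=
  pauliMat_expansion _

lemma conj_pauliMat' (U : Matrix (Fin 2) (Fin 2) ℂ) (b : Fin 4) :
    Uᴴ * pauliMat b * U = ∑ a, pauliTransfer U b a • pauliMat a := by
  conv_lhs => rw [pauliMat_expansion (Uᴴ * pauliMat b * U)]
  refine Finset.sum_congr rfl fun a _ => ?_
  congr 2
  rw [← mul_assoc, ← mul_assoc, Matrix.trace_mul_comm, Matrix.trace_mul_comm (pauliMat b)]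
  simp only [mul_assoc]

variable {U : Matrix (Fin 2) (Fin 2) ℂ}

lemma pauliTransfer_orthogonal (hU : U ∈ Matrix.unitaryGroup (Fin 2) ℂ) (a a' : Fin 4) :
    ∑ s, pauliTransfer U s a * pauliTransfer U s a' = if a = a' then 1 else 0 := by
  have h1 : Uᴴ * U = 1 := Matrix.mem_unitaryGroup_iff'.mp hU
  rw [← half_trace_pauliMat_mul]
  have h2 : (pauliMat a * pauliMat a').trace =
      ((U * pauliMat a * Uᴴ) * (U * pauliMat a' * Uᴴ)).trace := by
    have : (U * pauliMat a * Uᴴ) * (U * pauliMat a' * Uᴴ)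
        = U * (pauliMat a * ((Uᴴ * U) * pauliMat a') * Uᴴ) := by simp only [mul_assoc]
    rw [this, h1, one_mul, mul_assoc, Matrix.trace_mul_comm U, mul_assoc, mul_assoc, h1,
      mul_one]
  rw [h2, conj_pauliMat U a, Finset.sum_mul, Matrix.trace_sum, Finset.mul_sum]
  refine Finset.sum_congr rfl fun s _ => ?_
  rw [Matrix.smul_mul, Matrix.trace_smul, smul_eq_mul]
  conv_lhs => rw [pauliTransfer.eq_def U s a']
  ring

lemma pauliTransfer_zero_right (hU : U ∈ Matrix.unitaryGroup (Fin 2) ℂ) (b : Fin 4) :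
    pauliTransfer U b 0 = if b = 0 then 1 else 0 := by
  have h1 : U * Uᴴ = 1 := Matrix.mem_unitaryGroup_iff.mp hU
  rw [← half_trace_pauliMat_mul, pauliTransfer, pauliMat_zero, mul_one, h1]

lemma pauliTransfer_zero_left (hU : U ∈ Matrix.unitaryGroup (Fin 2) ℂ) (a : Fin 4) :
    pauliTransfer U 0 a = if a = 0 then 1 else 0 := by
  have h1 : Uᴴ * U = 1 := Matrix.mem_unitaryGroup_iff'.mp hU
  rw [← half_trace_pauliMat_mul, pauliTransfer, pauliMat_zero, one_mul, Matrix.trace_mul_comm,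
    ← mul_assoc, h1, one_mul, mul_one]

lemma exists_pauliTransfer_ne_zero (hU : U ∈ Matrix.unitaryGroup (Fin 2) ℂ) (a : Fin 4) :
    ∃ s, pauliTransfer U s a ≠ 0 := by
  by_contra! h
  simpa [h] using pauliTransfer_orthogonal hU a a

lemma eq_zero_iff_of_pauliTransfer_ne_zero (hU : U ∈ Matrix.unitaryGroup (Fin 2) ℂ)
    {b a : Fin 4} (h : pauliTransfer U b a ≠ 0) : b = 0 ↔ a = 0 := by
  constructor
  · rintro rfl
    simpa [pauliTransfer_zero_left hU] using h
  · rintro rfl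
    simpa [pauliTransfer_zero_right hU] using h

lemma conj_mul_conj (hU : U ∈ Matrix.unitaryGroup (Fin 2) ℂ) (A B : Matrix (Fin 2) (Fin 2) ℂ) :
    (U * A * Uᴴ) * (U * B * Uᴴ) = U * (A * B) * Uᴴ := by
  have h1 : Uᴴ * U = 1 := Matrix.mem_unitaryGroup_iff'.mp hU
  calc (U * A * Uᴴ) * (U * B * Uᴴ) = U * (A * ((Uᴴ * U) * B)) * Uᴴ := by simp only [mul_assoc]
    _ = _ := by rw [h1, one_mul]

lemma eq_smul_one_of_conj (hU : U ∈ Matrix.unitaryGroup (Fin 2) ℂ)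
    {A : Matrix (Fin 2) (Fin 2) ℂ} {r : ℂ} (h : U * A * Uᴴ = r • 1) : A = r • 1 := by
  have h1 : Uᴴ * U = 1 := Matrix.mem_unitaryGroup_iff'.mp hU
  calc A = (Uᴴ * U) * A * (Uᴴ * U) := by rw [h1, one_mul, mul_one]
    _ = Uᴴ * (U * A * Uᴴ) * U := by simp only [mul_assoc]
    _ = r • 1 := by rw [h, Matrix.mul_smul, mul_one, Matrix.smul_mul, h1]

/-- A unitary mapping two distinct Pauli matrices to multiples of Pauli matrices is Clifford. -/
lemma isClifford_of_conj_pauliMat (hU : U ∈ Matrix.unitaryGroup (Fin 2) ℂ) {p q : Fin 4}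
    (hp0 : p ≠ 0) (hq0 : q ≠ 0) (hpq : p ≠ q)
    (hp : ∃ r : ℂ, ∃ s, U * pauliMat p * Uᴴ = r • pauliMat s)
    (hq : ∃ r : ℂ, ∃ s, U * pauliMat q * Uᴴ = r • pauliMat s) : IsClifford U := by
  have h3 : ∃ r : ℂ, ∃ s, U * pauliMat (p ^^^ q) * Uᴴ = r • pauliMat s := by
    obtain ⟨r, s, hr⟩ := hp
    obtain ⟨r', s', hr'⟩ := hq
    obtain ⟨z, hz, hz'⟩ := pauliMat_mul p q
    obtain ⟨w, hw, hw'⟩ := pauliMat_mul s s'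
    refine ⟨z⁻¹ * (r * r' * w), s ^^^ s', ?_⟩
    have := conj_mul_conj hU (pauliMat p) (pauliMat q)
    rw [hr, hr', hz', Matrix.smul_mul, Matrix.mul_smul, hw', Matrix.mul_smul,
      Matrix.smul_mul] at this
    rw [mul_smul, mul_smul, mul_smul, this, inv_smul_smul₀ hz]
  have hall : ∀ u : Fin 4, u ≠ 0 → ∃ r : ℂ, ∃ s, U * pauliMat u * Uᴴ = r • pauliMat s := by
    intro u hu
    have : u = p ∨ u = q ∨ u = p ^^^ q := by
      clear hp hq h3
      revert p q u
      decide
    rcases this with rfl | rfl | rfl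
    exacts [hp, hq, h3]
  have hall' : ∀ u : Fin 3, ∃ v : Fin 3, ∃ r : ℂ, (r = 1 ∨ r = -1) ∧
      U * pauliMat u.succ * Uᴴ = r • pauliMat v.succ := by
    intro u
    obtain ⟨r, s, h⟩ := hall u.succ (Fin.succ_ne_zero u)
    have hs : s ≠ 0 := by
      rintro rfl
      exact Fin.succ_ne_zero u (eq_zero_of_pauliMat_eq_smul_one _ _ (eq_smul_one_of_conj hU h))
    obtain ⟨v, rfl⟩ := Fin.exists_succ_eq.mpr hs
    refine ⟨v, r, ?_, h⟩
    have h1 := conj_mul_conj hU (pauliMat u.succ) (pauliMat u.succ)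
    have h0 : U * Uᴴ = 1 := Matrix.mem_unitaryGroup_iff.mp hU
    rw [h, pauliMat_sq, Matrix.smul_mul, Matrix.mul_smul, pauliMat_sq, mul_one, h0,
      smul_smul] at h1
    have h2 := congrFun (congrFun h1 0) 0
    simp at h2
    exact mul_self_eq_one_iff.mp h2
  choose f r hr hf using hall'
  have hinj : Function.Injective f := by
    intro u v huv
    have h1 := conj_mul_conj hU (pauliMat u.succ) (pauliMat v.succ)
    rw [hf u, hf v, huv, Matrix.smul_mul, Matrix.mul_smul, pauliMat_sq, smul_smul] at h1
    have h2 := eq_smul_one_of_conj hU h1.symm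
    obtain ⟨z, hz, hz'⟩ := pauliMat_mul u.succ v.succ
    have h3 : pauliMat (u.succ ^^^ v.succ) = (z⁻¹ * (r u * r v)) • 1 := by
      rw [mul_smul, ← h2, hz', inv_smul_smul₀ hz]
    have h4 := eq_zero_of_pauliMat_eq_smul_one _ _ h3
    revert h4; clear * -; revert u v; decide
  exact ⟨hU, Equiv.ofBijective f (Finite.injective_iff_bijective.mp hinj),
    fun u => ⟨r u, hr u, hf u⟩⟩

end SingleQubit

section Kron

variable {ι : Type} [Fintype ι] [DecidableEq ι]

lemma kron_mul (A B : ι → Matrix (Fin 2) (Fin 2) ℂ) :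
    kron A * kron B = kron fun i => A i * B i := by
  ext x y
  simp only [kron, Matrix.mul_apply, Matrix.of_apply]
  rw [Finset.prod_univ_sum]
  simp only [Fintype.piFinset_univ, Finset.prod_mul_distrib]

omit [DecidableEq ι] in
lemma kron_one : kron (fun _ : ι => (1 : Matrix (Fin 2) (Fin 2) ℂ)) = 1 := by
  ext x y
  simp only [kron, Matrix.of_apply, Matrix.one_apply, Finset.prod_ite_zero, Finset.prod_const_one,
    Finset.mem_univ, true_implies, funext_iff]

omit [DecidableEq ι] in
lemma kron_conjTranspose (A : ι → Matrix (Fin 2) (Fin 2) ℂ) :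
    (kron A)ᴴ = kron fun i => (A i)ᴴ := by
  ext x y
  simp [kron, Matrix.conjTranspose_apply]

omit [DecidableEq ι] in
lemma kron_smul (r : ι → ℂ) (A : ι → Matrix (Fin 2) (Fin 2) ℂ) :
    kron (fun i => r i • A i) = (∏ i, r i) • kron A := by
  ext x y
  simp [kron, Finset.prod_mul_distrib]

lemma kron_sum (A : ι → Fin 4 → Matrix (Fin 2) (Fin 2) ℂ) :
    kron (fun i => ∑ p, A i p) = ∑ a : ι → Fin 4, kron fun i => A i (a i) := by
  ext x y
  simp only [kron, Matrix.of_apply, Matrix.sum_apply]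
  rw [Finset.prod_univ_sum, Fintype.piFinset_univ]

/-- The tensor product of Pauli matrices with the given labels. -/
noncomputable def pauliString (a : ι → Fin 4) : Matrix (ι → Fin 2) (ι → Fin 2) ℂ :=
  kron fun i => pauliMat (a i)

omit [DecidableEq ι] in
lemma pauliString_zero : pauliString (fun _ : ι => 0) = 1 := kron_one

lemma pauliString_sq (a : ι → Fin 4) : pauliString a * pauliString a = 1 := by
  simp only [pauliString, kron_mul, pauliMat_sq, kron_one]

omit [DecidableEq ι] in
lemma pauliString_conjTranspose (a : ι → Fin 4) : (pauliString a)ᴴ = pauliString a := by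
  simp only [pauliString, kron_conjTranspose, pauliMat_conjTranspose]

lemma pauliString_mul (a b : ι → Fin 4) :
    ∃ z : ℂ, z ≠ 0 ∧ pauliString a * pauliString b = z • pauliString fun i => a i ^^^ b i := by
  choose z hz h using fun i => pauliMat_mul (a i) (b i)
  refine ⟨∏ i, z i, Finset.prod_ne_zero_iff.mpr fun i _ => hz i, ?_⟩
  simp only [pauliString, kron_mul, h, kron_smul]

/-- The expectation value of a Pauli string in the state `ψ`. -/
noncomputable def pauliExp (ψ : (ι → Fin 2) → ℂ) (a : ι → Fin 4) : ℂ :=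
  star ψ ⬝ᵥ (pauliString a *ᵥ ψ)

lemma star_pauliExp (ψ : (ι → Fin 2) → ℂ) (a : ι → Fin 4) :
    star (pauliExp ψ a) = pauliExp ψ a := by
  rw [pauliExp, ← Matrix.star_dotProduct, Matrix.star_mulVec, pauliString_conjTranspose,
    ← Matrix.dotProduct_mulVec]

lemma kron_conj_pauliString (U : ι → Matrix (Fin 2) (Fin 2) ℂ) (b : ι → Fin 4) :
    (kron U)ᴴ * pauliString b * kron U =
      ∑ a : ι → Fin 4, (∏ i, pauliTransfer (U i) (b i) (a i)) • pauliString a := by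
  simp only [pauliString, kron_conjTranspose, kron_mul, conj_pauliMat', kron_sum, kron_smul]

lemma pauliExp_kron_mulVec (U : ι → Matrix (Fin 2) (Fin 2) ℂ) (ψ : (ι → Fin 2) → ℂ)
    (b : ι → Fin 4) :
    pauliExp (kron U *ᵥ ψ) b =
      ∑ a : ι → Fin 4, (∏ i, pauliTransfer (U i) (b i) (a i)) * pauliExp ψ a := by
  rw [pauliExp, Matrix.star_mulVec, ← Matrix.dotProduct_mulVec, Matrix.mulVec_mulVec,
    Matrix.mulVec_mulVec, kron_conj_pauliString, Matrix.sum_mulVec,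
    dotProduct_sum]
  refine Finset.sum_congr rfl fun a _ => ?_
  rw [Matrix.smul_mulVec, dotProduct_smul, smul_eq_mul, pauliExp]

/-- Exchange of the coordinates in `ω`. -/
def swapOn (ω : Finset ι) (x y : ι → Fin 2) : ι → Fin 2 :=
  fun i => if i ∈ ω then y i else x i

lemma sum_pauliExp_sq (ψ : (ι → Fin 2) → ℂ) (ω : Finset ι) :
    ∑ a ∈ Fintype.piFinset (fun i => if i ∈ ω then Finset.univ else {0}),
      pauliExp ψ a * pauliExp ψ a =
    2 ^ ω.card * ∑ x, ∑ y, star (ψ x) * star (ψ y) *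
      (ψ (swapOn ω x y) * ψ (swapOn ω y x)) := by
  have key : ∀ x u y v : ι → Fin 2,
      ∑ a ∈ Fintype.piFinset (fun i => if i ∈ ω then Finset.univ else {0}),
        pauliString a x u * pauliString a y v =
      if u = swapOn ω x y ∧ v = swapOn ω y x then 2 ^ ω.card else 0 := by
    intro x u y v
    simp only [pauliString, kron, Matrix.of_apply, ← Finset.prod_mul_distrib]
    rw [← Finset.prod_univ_sum (fun i => if i ∈ ω then Finset.univ else {0})
      (fun i p => pauliMat p (x i) (u i) * pauliMat p (y i) (v i))]
    have h : ∀ i, ∑ p ∈ (if i ∈ ω then Finset.univ else {0} : Finset (Fin 4)),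
        pauliMat p (x i) (u i) * pauliMat p (y i) (v i) =
        if u i = swapOn ω x y i ∧ v i = swapOn ω y x i then (if i ∈ ω then 2 else 1) else 0 := by
      intro i
      by_cases hi : i ∈ ω
      · simp only [hi, if_true, swapOn]
        rw [sum_pauliMat_mul_pauliMat]
      · simp only [hi, if_false, swapOn, Finset.sum_singleton, pauliMat_zero, Matrix.one_apply]
        simp only [eq_comm (a := x i), eq_comm (a := y i), ite_and, ite_mul, one_mul, zero_mul]
    simp only [h]
    rw [Finset.prod_ite_zero]
    simp only [funext_iff, Finset.mem_univ, true_implies, forall_and, Finset.prod_ite_mem,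
      Finset.univ_inter, Finset.prod_const]
  have expand : ∀ a, pauliExp ψ a * pauliExp ψ a = ∑ x, ∑ y, ∑ u, ∑ v,
      star (ψ x) * star (ψ y) * (ψ u * ψ v) * (pauliString a x u * pauliString a y v) := by
    intro a
    simp only [pauliExp, dotProduct, Matrix.mulVec, Pi.star_apply]
    rw [Finset.sum_mul_sum]
    refine Finset.sum_congr rfl fun x _ => Finset.sum_congr rfl fun y _ => ?_
    rw [mul_mul_mul_comm, Finset.sum_mul_sum, Finset.mul_sum]
    refine Finset.sum_congr rfl fun u _ => ?_
    rw [Finset.mul_sum]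
    refine Finset.sum_congr rfl fun v _ => ?_
    ring
  simp only [expand]
  rw [Finset.sum_comm, Finset.mul_sum]
  refine Finset.sum_congr rfl fun x _ => ?_
  rw [Finset.sum_comm, Finset.mul_sum]
  refine Finset.sum_congr rfl fun y _ => ?_
  rw [Finset.sum_comm]
  simp_rw [Finset.sum_comm (s := Fintype.piFinset _), ← Finset.mul_sum, key]
  rw [Finset.sum_eq_single (swapOn ω x y), Finset.sum_eq_single (swapOn ω y x)]
  · simp only [and_self, if_true]; ring
  · intro v _ hv; simp [hv]
  · simp
  · intro u _ hu; simp [hu]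
  · simp

lemma sum_star_mul_self (ψ : (ι → Fin 2) → ℂ) (h1 : ∑ x, Complex.normSq (ψ x) = 1) :
    ∑ x, star (ψ x) * ψ x = 1 := by
  have : ∀ x, star (ψ x) * ψ x = ((Complex.normSq (ψ x) : ℝ) : ℂ) :=
    fun x => Complex.normSq_eq_conj_mul_self.symm
  simp only [this, ← Complex.ofReal_sum, h1, Complex.ofReal_one]

lemma sum_sum_star_mul (ψ : (ι → Fin 2) → ℂ) (h1 : ∑ x, Complex.normSq (ψ x) = 1) :
    ∑ x, ∑ y, star (ψ x) * star (ψ y) * (ψ x * ψ y) = 1 := by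
  have h := sum_star_mul_self ψ h1
  calc ∑ x, ∑ y, star (ψ x) * star (ψ y) * (ψ x * ψ y)
      = (∑ x, star (ψ x) * ψ x) * ∑ y, star (ψ y) * ψ y := by
        rw [Finset.sum_mul_sum]
        refine Finset.sum_congr rfl fun x _ => Finset.sum_congr rfl fun y _ => by ring
    _ = 1 := by rw [h, one_mul]

lemma sum_pauliExp_sq_univ (ψ : (ι → Fin 2) → ℂ) (h1 : ∑ x, Complex.normSq (ψ x) = 1) :
    ∑ a, pauliExp ψ a * pauliExp ψ a = 2 ^ Fintype.card ι := by
  have h := sum_pauliExp_sq ψ Finset.univ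
  have e : ∀ x y : ι → Fin 2, swapOn Finset.univ x y = y := fun x y => by ext; simp [swapOn]
  simp only [Finset.mem_univ, if_true, Fintype.piFinset_univ, e, Finset.card_univ] at h
  rw [h]
  refine (congrArg _ ?_).trans (mul_one _)
  rw [← sum_sum_star_mul ψ h1]
  refine Finset.sum_congr rfl fun x _ => Finset.sum_congr rfl fun y _ => by ring

lemma pauliExp_sq_eq (ψ : (ι → Fin 2) → ℂ) (a : ι → Fin 4) :
    pauliExp ψ a * pauliExp ψ a = (((pauliExp ψ a).re ^ 2 : ℝ) : ℂ) := by
  have : ((pauliExp ψ a).re : ℂ) = pauliExp ψ a := Complex.conj_eq_iff_re.mp (star_pauliExp ψ a)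
  conv_lhs => rw [← this]
  push_cast; ring

end Kron

section Stabilizer

variable {ι : Type} [Fintype ι] [DecidableEq ι] {ψ : (ι → Fin 2) → ℂ}

lemma exists_ne_zero_of_normalized (h1 : ∑ x, Complex.normSq (ψ x) = 1) : ∃ x, ψ x ≠ 0 := by
  by_contra! h
  simp [h] at h1

lemma pauliExp_of_eigenvector (h1 : ∑ x, Complex.normSq (ψ x) = 1) {a : ι → Fin 4} {α : ℂ}
    (h : pauliString a *ᵥ ψ = α • ψ) : pauliExp ψ a = α := by
  rw [pauliExp, h, dotProduct_smul, smul_eq_mul, dotProduct]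
  simp only [Pi.star_apply]
  rw [sum_star_mul_self ψ h1, mul_one]

lemma pauliExp_sq_of_eigenvector (h1 : ∑ x, Complex.normSq (ψ x) = 1) {a : ι → Fin 4} {α : ℂ}
    (h : pauliString a *ᵥ ψ = α • ψ) : pauliExp ψ a * pauliExp ψ a = 1 := by
  obtain ⟨x, hx⟩ := exists_ne_zero_of_normalized h1
  have h2 : pauliString a *ᵥ (pauliString a *ᵥ ψ) = ψ := by
    rw [Matrix.mulVec_mulVec, pauliString_sq, Matrix.one_mulVec]
  rw [h, Matrix.mulVec_smul, h] at h2
  have h3 := congrFun h2 x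
  simp only [Pi.smul_apply, smul_eq_mul, ← mul_assoc] at h3
  rw [pauliExp_of_eigenvector h1 h]
  exact mul_right_cancel₀ hx (h3.trans (one_mul _).symm)

/-- Normalized vectors that are eigenvectors of every Pauli string with nonvanishing expectation
value. -/
def IsPauliEigenstate (ψ : (ι → Fin 2) → ℂ) : Prop :=
  ∑ x, Complex.normSq (ψ x) = 1 ∧
    ∀ a, pauliExp ψ a ≠ 0 → ∃ α : ℂ, pauliString a *ᵥ ψ = α • ψ

omit [DecidableEq ι] in
lemma PauliOp.toMatrix_eq (M : PauliOp ι) : M.toMatrix = M.phase • pauliString M.label := rfl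

omit [Fintype ι] [DecidableEq ι] in
lemma PauliOp.phase_ne_zero (M : PauliOp ι) : M.phase ≠ 0 := by
  rcases M.phase_ok with h | h | h | h <;> rw [h] <;> simp

lemma stabilizesState.mulVec_label {S : Stabilizer ι} (h : stabilizesState S ψ) {M : PauliOp ι}
    (hM : M ∈ S.elems) : pauliString M.label *ᵥ ψ = M.phase⁻¹ • ψ := by
  have := h.2 M hM
  rw [M.toMatrix_eq, Matrix.smul_mulVec] at this
  rw [eq_inv_smul_iff₀ M.phase_ne_zero, this]

lemma stabilizesState.label_injOn {S : Stabilizer ι} (h : stabilizesState S ψ) :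
    Set.InjOn PauliOp.label (S.elems : Set (PauliOp ι)) := by
  intro M hM N hN hMN
  have h1 := pauliExp_of_eigenvector h.1 (h.mulVec_label hM)
  have h2 := pauliExp_of_eigenvector h.1 (h.mulVec_label hN)
  rw [hMN, h2] at h1
  have h3 := inv_injective h1
  cases M; cases N
  simp_all

lemma stabilizesState.exists_of_pauliExp_ne_zero {S : Stabilizer ι} (h : stabilizesState S ψ)
    {a : ι → Fin 4} (ha : pauliExp ψ a ≠ 0) : ∃ M ∈ S.elems, M.label = a := by
  by_contra hcon
  set L := S.elems.image PauliOp.label with hL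
  have haL : a ∉ L := by simpa [hL] using hcon
  have hcard : L.card = 2 ^ Fintype.card ι := by
    rw [hL, Finset.card_image_of_injOn h.label_injOn, S.card_elems]
  have hone : ∀ b ∈ L, (pauliExp ψ b).re ^ 2 = 1 := by
    intro b hb
    obtain ⟨M, hM, rfl⟩ := Finset.mem_image.mp hb
    have := pauliExp_sq_of_eigenvector h.1 (h.mulVec_label hM)
    rw [pauliExp_sq_eq] at this
    exact_mod_cast this
  have hsum : ∑ b, (pauliExp ψ b).re ^ 2 = 2 ^ Fintype.card ι := by
    have := sum_pauliExp_sq_univ ψ h.1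
    simp only [pauliExp_sq_eq] at this
    exact_mod_cast this
  have hle : ∑ b ∈ insert a L, (pauliExp ψ b).re ^ 2 ≤ ∑ b, (pauliExp ψ b).re ^ 2 :=
    Finset.sum_le_sum_of_subset_of_nonneg (Finset.subset_univ _) fun _ _ _ => sq_nonneg _
  rw [Finset.sum_insert haL, Finset.sum_congr rfl hone, hsum, Finset.sum_const, hcard] at hle
  have hpos : (pauliExp ψ a).re ^ 2 ≤ 0 := by
    simpa using hle
  apply ha
  rw [← mul_self_eq_zero, pauliExp_sq_eq, le_antisymm hpos (sq_nonneg _), Complex.ofReal_zero]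

lemma stabilizesState.isPauliEigenstate {S : Stabilizer ι} (h : stabilizesState S ψ) :
    IsPauliEigenstate ψ := by
  refine ⟨h.1, fun a ha => ?_⟩
  obtain ⟨M, hM, rfl⟩ := h.exists_of_pauliExp_ne_zero ha
  exact ⟨_, h.mulVec_label hM⟩

lemma stabilizesState.pauliExp_label_ne_zero {S : Stabilizer ι} (h : stabilizesState S ψ)
    {M : PauliOp ι} (hM : M ∈ S.elems) : pauliExp ψ M.label ≠ 0 := by
  rw [pauliExp_of_eigenvector h.1 (h.mulVec_label hM)]
  exact inv_ne_zero M.phase_ne_zero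

lemma pauliExp_zero (h1 : ∑ x, Complex.normSq (ψ x) = 1) : pauliExp ψ (fun _ => 0) ≠ 0 := by
  rw [pauliExp_of_eigenvector (α := 1) h1 (by rw [pauliString_zero, Matrix.one_mulVec, one_smul])]
  exact one_ne_zero

lemma IsPauliEigenstate.pauliExp_sq (h : IsPauliEigenstate ψ) {a : ι → Fin 4}
    (ha : pauliExp ψ a ≠ 0) : pauliExp ψ a * pauliExp ψ a = 1 := by
  obtain ⟨α, hα⟩ := h.2 a ha
  exact pauliExp_sq_of_eigenvector h.1 hα

lemma IsPauliEigenstate.xor_ne_zero (h : IsPauliEigenstate ψ) {a b : ι → Fin 4}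
    (ha : pauliExp ψ a ≠ 0) (hb : pauliExp ψ b ≠ 0) :
    pauliExp ψ (fun i => a i ^^^ b i) ≠ 0 := by
  obtain ⟨α, hα⟩ := h.2 a ha
  obtain ⟨β, hβ⟩ := h.2 b hb
  obtain ⟨z, hz, hz'⟩ := pauliString_mul a b
  have h1 : pauliString (fun i => a i ^^^ b i) *ᵥ ψ = (z⁻¹ * (β * α)) • ψ := by
    rw [mul_smul, eq_inv_smul_iff₀ hz, ← Matrix.smul_mulVec, ← hz', ← Matrix.mulVec_mulVec, hβ,
      Matrix.mulVec_smul, hα, smul_smul]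
  rw [pauliExp_of_eigenvector h.1 hα] at ha
  rw [pauliExp_of_eigenvector h.1 hβ] at hb
  rw [pauliExp_of_eigenvector h.1 h1]
  exact mul_ne_zero (inv_ne_zero hz) (mul_ne_zero hb ha)

lemma not_fullyEntangled_of_swapOn (h1 : ∑ x, Complex.normSq (ψ x) = 1) {ω : Finset ι}
    (hω : ω ≠ ∅) (hω' : ω ≠ Finset.univ)
    (h : ∀ x y, ψ x * ψ y = ψ (swapOn ω x y) * ψ (swapOn ω y x)) : ¬ FullyEntangled ψ := by
  obtain ⟨x₀, hx₀⟩ := exists_ne_zero_of_normalized h1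
  intro hF
  refine hF ⟨ω, fun u => ψ (mergeAssign ω u fun i => x₀ i.1),
    fun v => ψ (mergeAssign ω (fun i => x₀ i.1) v) / ψ x₀, hω, hω', fun x => ?_⟩
  have e1 : swapOn ω x x₀ = mergeAssign ω (fun i => x₀ i.1) fun i => x i.1 := by
    ext i; by_cases hi : i ∈ ω <;> simp [swapOn, mergeAssign, hi]
  have e2 : swapOn ω x₀ x = mergeAssign ω (fun i => x i.1) fun i => x₀ i.1 := by
    ext i; by_cases hi : i ∈ ω <;> simp [swapOn, mergeAssign, hi]
  simp only
  rw [← e1, ← e2, ← mul_div_assoc, eq_div_iff hx₀, h, mul_comm]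

omit [Fintype ι] in
lemma swapOn_swapOn (ω : Finset ι) (x y : ι → Fin 2) :
    swapOn ω (swapOn ω x y) (swapOn ω y x) = x := by
  ext i; by_cases hi : i ∈ ω <;> simp [swapOn, hi]

lemma mul_eq_swapOn_mul (h1 : ∑ x, Complex.normSq (ψ x) = 1) (ω : Finset ι)
    (h : 1 ≤ (∑ x, ∑ y, star (ψ x) * star (ψ y) *
      (ψ (swapOn ω x y) * ψ (swapOn ω y x))).re) (x y : ι → Fin 2) :
    ψ x * ψ y = ψ (swapOn ω x y) * ψ (swapOn ω y x) := by
  let e : Equiv.Perm ((ι → Fin 2) × (ι → Fin 2)) :=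
    Function.Involutive.toPerm (fun p => (swapOn ω p.1 p.2, swapOn ω p.2 p.1))
      fun p => by simp only [swapOn_swapOn]
  have hN : ∑ p : (ι → Fin 2) × (ι → Fin 2), Complex.normSq (ψ p.1 * ψ p.2) = 1 := by
    simp only [Complex.normSq_mul, Fintype.sum_prod_type]
    rw [← Finset.sum_mul_sum, h1, one_mul]
  have hN' : ∑ p : (ι → Fin 2) × (ι → Fin 2),
      Complex.normSq (ψ (swapOn ω p.1 p.2) * ψ (swapOn ω p.2 p.1)) = 1 := by
    rw [← hN]
    exact Equiv.sum_comp e fun p => Complex.normSq (ψ p.1 * ψ p.2)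
  have hS : ∑ p : (ι → Fin 2) × (ι → Fin 2),
      Complex.normSq (ψ p.1 * ψ p.2 - ψ (swapOn ω p.1 p.2) * ψ (swapOn ω p.2 p.1)) ≤ 0 := by
    have : ∀ z w : ℂ, Complex.normSq (z - w) =
        Complex.normSq z + Complex.normSq w - 2 * (star z * w).re := by
      intro z w
      simp only [Complex.normSq_apply, Complex.sub_re, Complex.sub_im, Complex.mul_re,
        Complex.star_def, Complex.conj_re, Complex.conj_im]
      ring
    simp only [this, Finset.sum_sub_distrib, Finset.sum_add_distrib, hN, hN', ← Finset.mul_sum]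
    rw [← Complex.re_sum, Fintype.sum_prod_type]
    simp only [star_mul']
    linarith
  have hz := (Finset.sum_eq_zero_iff_of_nonneg fun p _ => Complex.normSq_nonneg _).mp
    (le_antisymm hS (Finset.sum_nonneg fun p _ => Complex.normSq_nonneg _)) (x, y)
    (Finset.mem_univ _)
  exact sub_eq_zero.mp (Complex.normSq_eq_zero.mp hz)

/-- A fully entangled state has fewer than `2 ^ #ω` stabilizing Pauli strings supported in a
proper subset `ω`. -/
lemma IsPauliEigenstate.card_lt (h : IsPauliEigenstate ψ) (hF : FullyEntangled ψ) {ω : Finset ι}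
    (hω : ω ≠ ∅) (hω' : ω ≠ Finset.univ) (F : Finset (ι → Fin 4))
    (hFψ : ∀ a ∈ F, pauliExp ψ a ≠ 0) (hFω : ∀ a ∈ F, ∀ i, i ∉ ω → a i = 0) :
    F.card < 2 ^ ω.card := by
  by_contra! hcard
  refine not_fullyEntangled_of_swapOn h.1 hω hω' (mul_eq_swapOn_mul h.1 ω ?_) hF
  have hsum := sum_pauliExp_sq ψ ω
  set s := ∑ x, ∑ y, star (ψ x) * star (ψ y) * (ψ (swapOn ω x y) * ψ (swapOn ω y x))
  simp only [pauliExp_sq_eq] at hsum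
  have hre := congrArg Complex.re hsum
  rw [← Complex.ofReal_sum, Complex.ofReal_re] at hre
  have h2 : ((2 : ℂ) ^ ω.card * s).re = 2 ^ ω.card * s.re := by
    have : (2 : ℂ) ^ ω.card = ((2 ^ ω.card : ℝ) : ℂ) := by push_cast; rfl
    rw [this, Complex.re_ofReal_mul]
  rw [h2] at hre
  have hsub : F ⊆ Fintype.piFinset (fun i => if i ∈ ω then Finset.univ else {0}) := by
    intro a ha
    rw [Fintype.mem_piFinset]
    intro i
    by_cases hi : i ∈ ω
    · simp [hi]
    · simp [hi, hFω a ha i hi]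
  have hle := Finset.sum_le_sum_of_subset_of_nonneg (f := fun a => (pauliExp ψ a).re ^ 2) hsub
    fun _ _ _ => sq_nonneg _
  have hone : ∀ a ∈ F, (pauliExp ψ a).re ^ 2 = 1 := by
    intro a ha
    have := h.pauliExp_sq (hFψ a ha)
    rw [pauliExp_sq_eq] at this
    exact_mod_cast this
  rw [Finset.sum_congr rfl hone, hre, Finset.sum_const, nsmul_eq_mul, mul_one] at hle
  have hc : (2 : ℝ) ^ ω.card ≤ F.card := by exact_mod_cast hcard
  have hp : (0 : ℝ) < 2 ^ ω.card := by positivity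
  exact le_of_mul_le_mul_left (by rw [mul_one]; exact hc.trans hle) hp

end Stabilizer

section LocalUnitary

variable {ι : Type} [Fintype ι] [DecidableEq ι] {ψ : (ι → Fin 2) → ℂ}

/-- Labels of stabilizing Pauli strings of `ψ` with minimal nonempty support. -/
def IsMinimalLabel (ψ : (ι → Fin 2) → ℂ) (a : ι → Fin 4) : Prop :=
  pauliExp ψ a ≠ 0 ∧ ∀ b, pauliExp ψ b ≠ 0 → (∀ i, a i = 0 → b i = 0) →
    (∃ i, a i ≠ 0 ∧ b i = 0) → ∀ i, b i = 0

lemma xor_eq_zero_iff_eq (p q : Fin 4) : p ^^^ q = 0 ↔ p = q := by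
  revert p q; decide

lemma IsMinimalLabel.eq_of_apply_eq (h : IsPauliEigenstate ψ) {a : ι → Fin 4}
    (ha : IsMinimalLabel ψ a) {b : ι → Fin 4} (hb : pauliExp ψ b ≠ 0)
    (hab : ∀ i, a i = 0 → b i = 0) {l : ι} (hl : a l ≠ 0) (hbl : b l = a l) : b = a := by
  have h0 := ha.2 _ (h.xor_ne_zero hb ha.1)
    (fun i hi => by rw [hi, hab i hi]; rfl) ⟨l, hl, by rw [hbl, xor_eq_zero_iff_eq]⟩
  exact funext fun i => (xor_eq_zero_iff_eq _ _).mp (h0 i)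

variable {U : ι → Matrix (Fin 2) (Fin 2) ℂ}

lemma exists_pauliExp_ne_zero_of_kron {b : ι → Fin 4}
    (hb : pauliExp (kron U *ᵥ ψ) b ≠ 0) :
    ∃ a, pauliExp ψ a ≠ 0 ∧ ∀ i, pauliTransfer (U i) (b i) (a i) ≠ 0 := by
  rw [pauliExp_kron_mulVec] at hb
  obtain ⟨a, -, ha⟩ := Finset.exists_ne_zero_of_sum_ne_zero hb
  exact ⟨a, right_ne_zero_of_mul ha,
    fun i => Finset.prod_ne_zero_iff.mp (left_ne_zero_of_mul ha) i (Finset.mem_univ i)⟩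

lemma IsMinimalLabel.eq_of_kron (hU : ∀ i, U i ∈ Matrix.unitaryGroup (Fin 2) ℂ)
    (hφ : IsPauliEigenstate (kron U *ᵥ ψ)) {a : ι → Fin 4} (ha : IsMinimalLabel ψ a)
    {b b' : ι → Fin 4} (hb : pauliExp (kron U *ᵥ ψ) b ≠ 0)
    (hb' : pauliExp (kron U *ᵥ ψ) b' ≠ 0) (hab : ∀ i, a i = 0 → b i = 0)
    (hab' : ∀ i, a i = 0 → b' i = 0) {l : ι} (hl : a l ≠ 0) (hbl : b l = b' l) : b = b' := by
  obtain ⟨c, hc, hc'⟩ := exists_pauliExp_ne_zero_of_kron (hφ.xor_ne_zero hb hb')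
  have hiff := fun i => eq_zero_iff_of_pauliTransfer_ne_zero (hU i) (hc' i)
  have h0 := ha.2 c hc (fun i hi => (hiff i).mp (by rw [hab i hi, hab' i hi]; rfl))
    ⟨l, hl, (hiff l).mp (by rw [hbl, xor_eq_zero_iff_eq])⟩
  exact funext fun i => (xor_eq_zero_iff_eq _ _).mp ((hiff i).mpr (h0 i))

lemma sum_pauliTransfer_mul_pauliExp_update (hU : ∀ i, U i ∈ Matrix.unitaryGroup (Fin 2) ℂ)
    (b : ι → Fin 4) (i : ι) (p : Fin 4) :
    ∑ s, pauliTransfer (U i) s p * pauliExp (kron U *ᵥ ψ) (Function.update b i s) =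
      ∑ a : ι → Fin 4, if a i = p then
        (∏ j ∈ Finset.univ.erase i, pauliTransfer (U j) (b j) (a j)) * pauliExp ψ a else 0 := by
  simp only [pauliExp_kron_mulVec, Finset.mul_sum]
  rw [Finset.sum_comm]
  refine Finset.sum_congr rfl fun a _ => ?_
  have h : ∀ s, ∏ j, pauliTransfer (U j) (Function.update b i s j) (a j) =
      pauliTransfer (U i) s (a i) *
        ∏ j ∈ Finset.univ.erase i, pauliTransfer (U j) (b j) (a j) := by
    intro s
    rw [← Finset.mul_prod_erase _ _ (Finset.mem_univ i), Function.update_self]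
    congr 1
    refine Finset.prod_congr rfl fun j hj => ?_
    rw [Function.update_of_ne (Finset.ne_of_mem_erase hj)]
  simp only [h]
  have h2 : ∀ s, pauliTransfer (U i) s p * (pauliTransfer (U i) s (a i) *
      (∏ j ∈ Finset.univ.erase i, pauliTransfer (U j) (b j) (a j)) * pauliExp ψ a) =
      (pauliTransfer (U i) s (a i) * pauliTransfer (U i) s p) *
      ((∏ j ∈ Finset.univ.erase i, pauliTransfer (U j) (b j) (a j)) * pauliExp ψ a) :=
    fun s => by ring
  simp only [h2]
  rw [← Finset.sum_mul, pauliTransfer_orthogonal (hU i), ite_mul, one_mul, zero_mul]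

lemma IsMinimalLabel.exists_update (hψ : IsPauliEigenstate ψ)
    (hU : ∀ i, U i ∈ Matrix.unitaryGroup (Fin 2) ℂ) {a : ι → Fin 4} (ha : IsMinimalLabel ψ a)
    {b : ι → Fin 4} {i : ι} (hi : a i ≠ 0)
    (hb : ∀ j, j ≠ i → pauliTransfer (U j) (b j) (a j) ≠ 0) :
    ∃ s, pauliExp (kron U *ᵥ ψ) (Function.update b i s) ≠ 0 := by
  by_contra! hcon
  have h := sum_pauliTransfer_mul_pauliExp_update (ψ := ψ) hU b i (a i)
  simp only [hcon, mul_zero, Finset.sum_const_zero] at h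
  rw [Finset.sum_eq_single a] at h
  · rw [if_pos rfl] at h
    refine mul_ne_zero (Finset.prod_ne_zero_iff.mpr fun j hj => ?_) ha.1 h.symm
    exact hb j (Finset.ne_of_mem_erase hj)
  · intro c _ hc
    by_contra hne
    have hci : c i = a i := by
      by_contra hci
      exact hne (if_neg hci)
    rw [if_pos hci] at hne
    refine hc (ha.eq_of_apply_eq hψ (right_ne_zero_of_mul hne) (fun j hj => ?_) hi hci)
    have hji : j ≠ i := fun e => hi (e ▸ hj)
    have h1 := Finset.prod_ne_zero_iff.mp (left_ne_zero_of_mul hne) j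
      (Finset.mem_erase.mpr ⟨hji, Finset.mem_univ j⟩)
    rw [← eq_zero_iff_of_pauliTransfer_ne_zero (hU j) h1,
      eq_zero_iff_of_pauliTransfer_ne_zero (hU j) (hb j hji), hj]
  · simp

lemma IsMinimalLabel.pauliTransfer_unique_of_three_le (hψ : IsPauliEigenstate ψ)
    (hU : ∀ i, U i ∈ Matrix.unitaryGroup (Fin 2) ℂ) (hφ : IsPauliEigenstate (kron U *ᵥ ψ))
    {a : ι → Fin 4} (ha : IsMinimalLabel ψ a) {i j k : ι} (hij : i ≠ j) (hjk : j ≠ k)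
    (hik : i ≠ k) (hi : a i ≠ 0) (hk : a k ≠ 0) {s t : Fin 4}
    (hs : pauliTransfer (U j) s (a j) ≠ 0) (ht : pauliTransfer (U j) t (a j) ≠ 0) : s = t := by
  choose b hb using fun l => exists_pauliTransfer_ne_zero (hU l) (a l)
  have key : ∀ p, pauliTransfer (U j) p (a j) ≠ 0 →
      ∃ c, pauliExp (kron U *ᵥ ψ) c ≠ 0 ∧ c j = p ∧ c k = b k ∧ ∀ l, a l = 0 → c l = 0 := by
    intro p hp
    have hbp : ∀ l, pauliTransfer (U l) (Function.update b j p l) (a l) ≠ 0 := by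
      intro l
      by_cases hl : l = j
      · subst hl; rwa [Function.update_self]
      · rw [Function.update_of_ne hl]; exact hb l
    obtain ⟨u, hu⟩ := ha.exists_update hψ hU (b := Function.update b j p) hi fun l _ => hbp l
    refine ⟨_, hu, ?_, ?_, fun l hl => ?_⟩
    · rw [Function.update_of_ne hij.symm, Function.update_self]
    · rw [Function.update_of_ne hik.symm, Function.update_of_ne hjk.symm]
    · have hli : l ≠ i := fun e => hi (e ▸ hl)
      rw [Function.update_of_ne hli]
      exact (eq_zero_iff_of_pauliTransfer_ne_zero (hU l) (hbp l)).mpr hl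
  obtain ⟨c, hc, hcj, hck, hca⟩ := key s hs
  obtain ⟨d, hd, hdj, hdk, hda⟩ := key t ht
  rw [← hcj, ← hdj, ha.eq_of_kron hU hφ hc hd hca hda hk (hck.trans hdk.symm)]

lemma IsMinimalLabel.pauliTransfer_unique_of_unique
    (hU : ∀ i, U i ∈ Matrix.unitaryGroup (Fin 2) ℂ) (hφ : IsPauliEigenstate (kron U *ᵥ ψ))
    {a : ι → Fin 4} (ha : IsMinimalLabel ψ a) {j k : ι} (hjk : j ≠ k) (hk : a k ≠ 0)
    (huniq : ∀ c, pauliExp ψ c ≠ 0 → (∀ i, c i = 0 ↔ a i = 0) → c = a) {s t : Fin 4}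
    (hs : pauliTransfer (U j) s (a j) ≠ 0) (ht : pauliTransfer (U j) t (a j) ≠ 0) : s = t := by
  choose b hb using fun l => exists_pauliTransfer_ne_zero (hU l) (a l)
  have key : ∀ p, pauliTransfer (U j) p (a j) ≠ 0 →
      pauliExp (kron U *ᵥ ψ) (Function.update b j p) ≠ 0 ∧
        ∀ l, a l = 0 → Function.update b j p l = 0 := by
    intro p hp
    have hbp : ∀ l, pauliTransfer (U l) (Function.update b j p l) (a l) ≠ 0 := by
      intro l
      by_cases hl : l = j
      · subst hl; rwa [Function.update_self]
      · rw [Function.update_of_ne hl]; exact hb l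
    have hz := fun l => eq_zero_iff_of_pauliTransfer_ne_zero (hU l) (hbp l)
    refine ⟨?_, fun l => (hz l).mpr⟩
    rw [pauliExp_kron_mulVec, Finset.sum_eq_single a]
    · exact mul_ne_zero (Finset.prod_ne_zero_iff.mpr fun l _ => hbp l) ha.1
    · intro c _ hc
      by_contra hne
      refine hc (huniq c (right_ne_zero_of_mul hne) fun l => ?_)
      have h1 := Finset.prod_ne_zero_iff.mp (left_ne_zero_of_mul hne) l (Finset.mem_univ l)
      rw [← eq_zero_iff_of_pauliTransfer_ne_zero (hU l) h1, hz l]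
    · simp
  have := ha.eq_of_kron hU hφ (key s hs).1 (key t ht).1 (key s hs).2 (key t ht).2 hk
    (by rw [Function.update_of_ne hjk.symm, Function.update_of_ne hjk.symm])
  simpa using congrFun this j

/-- Local unitaries between stabilizer states map the one-qubit factors of minimal elements to
multiples of Pauli matrices. -/
lemma IsMinimalLabel.exists_conj_eq_smul (hψ : IsPauliEigenstate ψ) (hF : FullyEntangled ψ)
    (hcard : 3 ≤ Fintype.card ι) (hU : ∀ i, U i ∈ Matrix.unitaryGroup (Fin 2) ℂ)
    (hφ : IsPauliEigenstate (kron U *ᵥ ψ)) {a : ι → Fin 4} (ha : IsMinimalLabel ψ a) {j : ι}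
    (hj : a j ≠ 0) : ∃ r : ℂ, ∃ s, U j * pauliMat (a j) * (U j)ᴴ = r • pauliMat s := by
  obtain ⟨s, hs⟩ := exists_pauliTransfer_ne_zero (hU j) (a j)
  suffices h : ∀ t, pauliTransfer (U j) t (a j) ≠ 0 → t = s by
    refine ⟨pauliTransfer (U j) s (a j), s, ?_⟩
    rw [conj_pauliMat, Finset.sum_eq_single s]
    · intro t _ ht
      rw [not_not.mp (mt (h t) ht), zero_smul]
    · simp
  intro t ht
  set ω : Finset ι := Finset.univ.filter fun i => a i ≠ 0 with hω
  have hjω : j ∈ ω := by simp [hω, hj]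
  have hmem : ∀ i, i ∈ ω ↔ a i ≠ 0 := fun i => by simp [hω]
  rcases Nat.lt_or_ge 2 ω.card with h3 | h2
  · obtain ⟨i, hi⟩ : (ω.erase j).Nonempty := by
      rw [← Finset.card_pos, Finset.card_erase_of_mem hjω]; omega
    obtain ⟨k, hk⟩ : ((ω.erase j).erase i).Nonempty := by
      rw [← Finset.card_pos, Finset.card_erase_of_mem hi, Finset.card_erase_of_mem hjω]; omega
    simp only [Finset.mem_erase] at hi hk
    exact ha.pauliTransfer_unique_of_three_le hψ hU hφ hi.1 hk.2.1.symm hk.1.symm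
      ((hmem i).mp hi.2) ((hmem k).mp hk.2.2) ht hs
  have hω0 : ω ≠ ∅ := Finset.ne_empty_of_mem hjω
  have hω1 : ω ≠ Finset.univ := by
    intro h
    rw [h, Finset.card_univ] at h2
    omega
  have ha0 : a ≠ fun _ => 0 := fun h => hj (congrFun h j)
  have hlt : ∀ F : Finset (ι → Fin 4), (∀ b ∈ F, pauliExp ψ b ≠ 0) →
      (∀ b ∈ F, ∀ i, i ∉ ω → b i = 0) → F.card < 2 ^ ω.card :=
    hψ.card_lt hF hω0 hω1
  have hne1 : 1 < ω.card := by
    have := hlt {fun _ => 0, a} (by simpa using ⟨pauliExp_zero hψ.1, ha.1⟩)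
      (by simpa using fun i hi => not_not.mp (mt (hmem i).mpr hi))
    rw [Finset.card_pair ha0.symm] at this
    by_contra hcon
    have hp : 2 ^ ω.card ≤ 2 ^ 1 := Nat.pow_le_pow_right (by norm_num) (by omega)
    omega
  have hc2 : ω.card = 2 := by omega
  obtain ⟨k, hk⟩ : (ω.erase j).Nonempty := by
    rw [← Finset.card_pos, Finset.card_erase_of_mem hjω]; omega
  simp only [Finset.mem_erase] at hk
  refine ha.pauliTransfer_unique_of_unique hU hφ hk.1.symm ((hmem k).mp hk.2) ?_ ht hs
  intro c hc hca
  by_contra hne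
  have hc0 : c ≠ fun _ => 0 := fun h => hj ((hca j).mp (congrFun h j))
  set d : ι → Fin 4 := fun i => c i ^^^ a i with hd
  have hd0 : d ≠ fun _ => 0 := fun h =>
    hne (funext fun i => (xor_eq_zero_iff_eq _ _).mp (congrFun h i))
  have hxa : ∀ p q : Fin 4, p ^^^ q = q ↔ p = 0 := by decide
  have hxc : ∀ p q : Fin 4, p ^^^ q = p ↔ q = 0 := by decide
  have hda : d ≠ a := fun h => hc0 (funext fun i => (hxa _ _).mp (congrFun h i))
  have hdc : d ≠ c := fun h => ha0 (funext fun i => (hxc _ _).mp (congrFun h i))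
  have hz : ∀ i, i ∉ ω → a i = 0 := fun i hi => not_not.mp (mt (hmem i).mpr hi)
  have := hlt {fun _ => 0, a, c, d}
    (by
      intro b hb
      simp only [Finset.mem_insert, Finset.mem_singleton] at hb
      rcases hb with rfl | rfl | rfl | rfl
      exacts [pauliExp_zero hψ.1, ha.1, hc, hψ.xor_ne_zero hc ha.1])
    (by
      intro b hb i hi
      simp only [Finset.mem_insert, Finset.mem_singleton] at hb
      rcases hb with rfl | rfl | rfl | rfl
      · rfl
      · exact hz i hi
      · exact (hca i).mpr (hz i hi)
      · simp only [hd]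
        rw [(hca i).mpr (hz i hi), hz i hi]; rfl)
  have hcard4 : ({fun _ => 0, a, c, d} : Finset (ι → Fin 4)).card = 4 := by
    rw [Finset.card_insert_of_notMem, Finset.card_insert_of_notMem, Finset.card_pair hdc.symm]
    · simpa using ⟨fun h => hne h.symm, hda.symm⟩
    · simpa using ⟨ha0.symm, hc0.symm, hd0.symm⟩
  rw [hcard4, hc2] at this
  omega

lemma IsPauliEigenstate.card_pauliExp_ne_zero (h : IsPauliEigenstate ψ) :
    (Finset.univ.filter fun a => pauliExp ψ a ≠ 0).card = 2 ^ Fintype.card ι := by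
  have h1 := sum_pauliExp_sq_univ ψ h.1
  have h2 : ∀ a, pauliExp ψ a * pauliExp ψ a = if pauliExp ψ a ≠ 0 then 1 else 0 := by
    intro a
    by_cases ha : pauliExp ψ a = 0
    · simp [ha]
    · rw [if_pos ha, h.pauliExp_sq ha]
  rw [Finset.sum_congr rfl fun a _ => h2 a, Finset.sum_boole] at h1
  exact_mod_cast h1

/-- The stabilizing Pauli strings of a fully entangled state do not commute pairwise at any
qubit. -/
lemma IsPauliEigenstate.exists_apply_ne (h : IsPauliEigenstate ψ) (hF : FullyEntangled ψ)
    (hcard : 3 ≤ Fintype.card ι) (i : ι) (s : Fin 4) :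
    ∃ a, pauliExp ψ a ≠ 0 ∧ a i ≠ 0 ∧ a i ≠ s := by
  by_contra! hcon
  set L := Finset.univ.filter fun a => pauliExp ψ a ≠ 0 with hL
  have hLc : L.card = 2 ^ Fintype.card ι := h.card_pauliExp_ne_zero
  have hmem : ∀ a, a ∈ L ↔ pauliExp ψ a ≠ 0 := fun a => by simp [hL]
  have hle : (L.filter fun a => ¬ a i = 0).card ≤ (L.filter fun a => a i = 0).card := by
    rcases (L.filter fun a => ¬ a i = 0).eq_empty_or_nonempty with he | ⟨g, hg⟩
    · rw [he]; simp
    rw [Finset.mem_filter, hmem] at hg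
    refine Finset.card_le_card_of_injOn (fun a l => a l ^^^ g l) (fun a ha => ?_) ?_
    · have ha' := Finset.mem_filter.mp (Finset.mem_coe.mp ha)
      rw [hmem] at ha'
      refine Finset.mem_coe.mpr (Finset.mem_filter.mpr
        ⟨(hmem _).mpr (h.xor_ne_zero ha'.1 hg.1), ?_⟩)
      rw [xor_eq_zero_iff_eq, hcon a ha'.1 ha'.2, hcon g hg.1 hg.2]
    · intro a _ b _ hab
      have hx : ∀ p q r : Fin 4, p ^^^ r = q ^^^ r → p = q := by decide
      exact funext fun l => hx _ _ _ (congrFun hab l)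
  have hadd := Finset.card_filter_add_card_filter_not (s := L) (fun a => a i = 0)
  have hlt := h.card_lt hF (ω := {i}ᶜ)
    (by
      intro he
      have := congrArg Finset.card he
      rw [Finset.card_compl, Finset.card_singleton, Finset.card_empty] at this
      omega)
    (by
      intro he
      have := Finset.mem_univ i
      rw [← he] at this
      simp at this)
    (L.filter fun a => a i = 0)
    (fun a ha => (hmem a).mp (Finset.mem_filter.mp ha).1)
    (fun a ha l hl => by
      have : l = i := by simpa using hl
      rw [this]; exact (Finset.mem_filter.mp ha).2)
  rw [Finset.card_compl, Finset.card_singleton] at hlt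
  obtain ⟨m, hm⟩ : ∃ m, Fintype.card ι = m + 1 := ⟨Fintype.card ι - 1, by omega⟩
  rw [hm, Nat.add_sub_cancel] at hlt
  rw [hm, pow_succ] at hLc
  omega

lemma stabilizesState.isMinimalLabel {S : Stabilizer ι} (h : stabilizesState S ψ) {M : PauliOp ι}
    (hM : M ∈ S.elems) (hmin : IsMinimalSupport S M.support) : IsMinimalLabel ψ M.label := by
  refine ⟨h.pauliExp_label_ne_zero hM, fun b hb hab ⟨i, hi, hbi⟩ => ?_⟩
  obtain ⟨N, hN, rfl⟩ := h.exists_of_pauliExp_ne_zero hb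
  have hsub : N.support ⊂ M.support := by
    rw [Finset.ssubset_iff_of_subset]
    · exact ⟨i, by simp [PauliOp.support, hi], by simp [PauliOp.support, hbi]⟩
    · intro l hl
      simp only [PauliOp.support, Finset.mem_filter, Finset.mem_univ, true_and] at hl ⊢
      exact mt (hab l) hl
  have he := hmin.2 N hN hsub
  intro l
  by_contra hl
  have : l ∈ N.support := by simp [PauliOp.support, hl]
  simp [he] at this

lemma pauliString_single_commute {a : ι → Fin 4} {i : ι} {s : Fin 4} (h : a i = 0 ∨ a i = s) :
    pauliString (Pi.single i s) * pauliString a = pauliString a * pauliString (Pi.single i s) := by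
  simp only [pauliString, kron_mul]
  congr 1
  funext j
  by_cases hj : j = i
  · subst hj
    rcases h with h | h <;> simp [h, pauliMat_zero]
  · simp [hj, pauliMat_zero]

lemma pauliString_single_anticommute {a : ι → Fin 4} {i : ι} {s : Fin 4} (hs : s ≠ 0)
    (h0 : a i ≠ 0) (h : a i ≠ s) :
    pauliString (Pi.single i s) * pauliString a =
      (-1 : ℂ) • (pauliString a * pauliString (Pi.single i s)) := by
  have hp : ∏ j : ι, (if j = i then (-1 : ℂ) else 1) = -1 := by simp
  simp only [pauliString, kron_mul]
  rw [← hp, ← kron_smul]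
  congr 1
  funext j
  by_cases hj : j = i
  · subst hj
    rw [if_pos rfl, Pi.single_eq_same, pauliMat_anticomm _ _ hs h0 h.symm]
  · simp [hj, pauliMat_zero]

lemma stabilizesState.exists_minimal_pair {S : Stabilizer ι} (h : stabilizesState S ψ)
    (hF : FullyEntangled ψ) (hcard : 3 ≤ Fintype.card ι)
    (hgen : ∀ M ∈ S.elems, inMinimalSubgroup S M) (i : ι) :
    ∃ a b, IsMinimalLabel ψ a ∧ IsMinimalLabel ψ b ∧ a i ≠ 0 ∧ b i ≠ 0 ∧ a i ≠ b i := by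
  by_contra! hcon
  obtain ⟨s, hs, hmin⟩ : ∃ s : Fin 4, s ≠ 0 ∧ ∀ a, IsMinimalLabel ψ a → a i = 0 ∨ a i = s := by
    by_cases hex : ∃ a, IsMinimalLabel ψ a ∧ a i ≠ 0
    · obtain ⟨a, ha, hai⟩ := hex
      refine ⟨a i, hai, fun b hb => or_iff_not_imp_left.mpr fun hbi => hcon b a hb ha hbi hai⟩
    · push Not at hex
      exact ⟨1, by decide, fun a ha => Or.inl (hex a ha)⟩
  have hcomm : Submonoid.closure (minimalMatrices S) ≤
      Submonoid.centralizer {pauliString (Pi.single i s)} := by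
    rw [Submonoid.closure_le]
    rintro A ⟨M, hM, hMmin, rfl⟩
    rw [SetLike.mem_coe, Submonoid.mem_centralizer_iff]
    rintro _ rfl
    rw [M.toMatrix_eq, Matrix.mul_smul, Matrix.smul_mul,
      pauliString_single_commute (hmin _ (h.isMinimalLabel hM hMmin))]
  obtain ⟨a, ha, ha0, has⟩ := h.isPauliEigenstate.exists_apply_ne hF hcard i s
  obtain ⟨M, hM, rfl⟩ := h.exists_of_pauliExp_ne_zero ha
  have h1 := Submonoid.mem_centralizer_iff.mp (hcomm (hgen M hM).2) _ (Set.mem_singleton _)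
  rw [M.toMatrix_eq, Matrix.mul_smul, Matrix.smul_mul,
    pauliString_single_anticommute hs ha0 has] at h1
  have h2 := smul_right_injective _ M.phase_ne_zero h1
  set Q := pauliString (Pi.single i s : ι → Fin 4)
  have h3 : pauliString M.label * Q = 0 := by
    rw [neg_one_smul] at h2
    ext x y
    exact neg_eq_self.mp (congrFun (congrFun h2 x) y)
  have h4 : (1 : Matrix (ι → Fin 2) (ι → Fin 2) ℂ) = 0 := by
    calc (1 : Matrix (ι → Fin 2) (ι → Fin 2) ℂ)
        = pauliString M.label * (pauliString M.label * Q) * Q := by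
          rw [← mul_assoc (pauliString M.label), pauliString_sq, one_mul, pauliString_sq]
      _ = 0 := by rw [h3, mul_zero, zero_mul]
  exact one_ne_zero h4

end LocalUnitary

/-- If `ψ` is a fully entangled stabilizer state on `n ≥ 3` qubits whose
stabilizer is generated by its minimal elements (`𝒮(ψ) = ℳ(ψ)`), then `LU(ψ) = LC(ψ)`. -/
theorem stmt_3 {n : ℕ} (hn : 3 ≤ n) (S : Stabilizer (Fin n)) (ψ : (Fin n → Fin 2) → ℂ)
    (hψ : stabilizesState S ψ) (hent : FullyEntangled ψ)
    (hgen : ∀ M ∈ S.elems, inMinimalSubgroup S M) :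
    ∀ φ : (Fin n → Fin 2) → ℂ, IsStabilizerState φ → (LUequiv ψ φ ↔ LCequiv ψ φ) := by
  rintro φ ⟨T, hT⟩
  refine ⟨?_, fun ⟨U, hU, h⟩ => ⟨U, fun i => (hU i).1, h⟩⟩
  rintro ⟨U, hU, rfl⟩
  have hcard : 3 ≤ Fintype.card (Fin n) := by rwa [Fintype.card_fin]
  refine ⟨U, fun i => ?_, rfl⟩
  obtain ⟨a, b, ha, hb, ha0, hb0, hab⟩ := hψ.exists_minimal_pair hent hcard hgen i
  have hψ' := hψ.isPauliEigenstate
  have hφ' := hT.isPauliEigenstate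
  exact isClifford_of_conj_pauliMat (hU i) ha0 hb0 hab
    (ha.exists_conj_eq_smul hψ' hent hcard hU hφ' ha0) (hb.exists_conj_eq_smul hψ' hent hcard hU hφ' hb0)
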